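/- Let i ∈ {1,2} and let q be an action minimizer of A over P(Q_S, Q_{E_i}) that is differentiable from the right at t = 0 and has no collision at t = 0 (equivalently, in the representation q(0) = ((−a₁₁−c₁₁,0), (−a₁₁,0), ((2a₁₁+c₁₁)/2, b₁₁), ((2a₁₁+c₁₁)/2, −b₁₁)) one has b₁₁ > 0 and c₁₁ > 0). Then the first-variation conditions at t = 0 force the velocity relations q̇_{1x}(0) = q̇_{2x}(0) = 0, q̇_{3x}(0) = −q̇_{4x}(0), and q̇_{3y}(0) = q̇_{4y}(0). -/

import Mathlib

open Real MeasureTheory Set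
open scoped ENNReal

noncomputable section

/-- Euclidean norm on `ℝ × ℝ` (row vectors in the plane). -/
def enorm2 (v : ℝ × ℝ) : ℝ := Real.sqrt (v.1 ^ 2 + v.2 ^ 2)

/-- Row vector multiplied on the right by the rotation matrix `R θ`
with rows `(cos θ, sin θ)` and `(-sin θ, cos θ)`. -/
def rotV (θ : ℝ) (v : ℝ × ℝ) : ℝ × ℝ :=
  (v.1 * Real.cos θ - v.2 * Real.sin θ, v.1 * Real.sin θ + v.2 * Real.cos θ)

/-- `H¹([0,1],(ℝ²)⁴)`: absolutely continuous paths `[0,1] → (ℝ²)⁴` with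
square-integrable derivative, recorded via an integrable (a.e.-)derivative `v`
together with the integral representation of `q`. -/
structure H1Path4 where
  q : ℝ → Fin 4 → ℝ × ℝ
  v : ℝ → Fin 4 → ℝ × ℝ
  hvInt : ∀ i : Fin 4, IntegrableOn (fun t => v t i) (Icc (0:ℝ) 1)
  hrep : ∀ i : Fin 4, ∀ t ∈ Icc (0:ℝ) 1, q t i = q 0 i + ∫ s in (0:ℝ)..t, v s i
  hL2 : ∀ i : Fin 4, IntegrableOn (fun t => enorm2 (v t i) ^ 2) (Icc (0:ℝ) 1)

/-- Center of mass at the origin throughout `[0,1]` (the path lies in `χ`). -/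
def H1Path4.inChi (p : H1Path4) : Prop := ∀ t ∈ Icc (0:ℝ) 1, ∑ i, p.q t i = 0

/-- The Lagrangian action functional `A`, with value `+∞` allowed. -/
def action (p : H1Path4) : ℝ≥0∞ :=
  ∫⁻ t in Icc (0:ℝ) 1,
    (ENNReal.ofReal ((1/2) * ∑ i, enorm2 (p.v t i) ^ 2)
      + ∑ i : Fin 4, ∑ j ∈ Finset.univ.filter (fun j => i < j),
          (ENNReal.ofReal (enorm2 (p.q t i - p.q t j)))⁻¹)

/-- The starting boundary configuration set `Q_S` (double isosceles with order
constraints). -/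
def QSset : Set (Fin 4 → ℝ × ℝ) :=
  { c | ∃ a₁ b₁ c₁ : ℝ, 0 ≤ b₁ ∧ 0 ≤ c₁ ∧
      c = ![(-a₁ - c₁, 0), (-a₁, 0), ((2*a₁ + c₁)/2, b₁), ((2*a₁ + c₁)/2, -b₁)] }

/-- The ending boundary configuration set `Q_{E₁}`. -/
def QE1set (θ : ℝ) : Set (Fin 4 → ℝ × ℝ) :=
  { c | ∃ a₂ b₂ c₂ : ℝ, 0 ≤ b₂ ∧ 0 ≤ c₂ ∧
      c = fun i => rotV θ (![(-b₂, -a₂), (-c₂, a₂), (c₂, a₂), (b₂, -a₂)] i) }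

/-- The ending boundary configuration set `Q_{E₂}`. -/
def QE2set (θ : ℝ) : Set (Fin 4 → ℝ × ℝ) :=
  { c | ∃ a₂ b₂ c₂ : ℝ, 0 ≤ b₂ ∧ 0 ≤ c₂ ∧
      c = fun i => rotV θ (![(-a₂, -b₂), (-a₂, b₂), (a₂, c₂), (a₂, -c₂)] i) }

/-- Membership in the admissible class `P(Q_S, E)`. -/
def inAdm (E : Set (Fin 4 → ℝ × ℝ)) (p : H1Path4) : Prop :=
  p.inChi ∧ p.q 0 ∈ QSset ∧ p.q 1 ∈ E

/-- `p` is an action minimizer over `P(Q_S, E)`. -/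
def isMin (E : Set (Fin 4 → ℝ × ℝ)) (p : H1Path4) : Prop :=
  inAdm E p ∧ ∀ p' : H1Path4, inAdm E p' → action p ≤ action p'

/-- The Newtonian equations of the equal-mass four-body problem, on a set `s`
of times. -/
def newton (Q : ℝ → Fin 4 → ℝ × ℝ) (s : Set ℝ) : Prop :=
  ∀ i : Fin 4, ∀ t ∈ s,
    deriv (deriv (fun u => Q u i)) t =
      ∑ j ∈ Finset.univ.erase i, (1 / enorm2 (Q t j - Q t i) ^ 3) • (Q t j - Q t i)

lemma enorm2_sq (v : ℝ × ℝ) : enorm2 v ^ 2 = v.1 ^ 2 + v.2 ^ 2 :=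
  Real.sq_sqrt (by positivity)

lemma enorm2_pos {v : ℝ × ℝ} (hv : v ≠ 0) : 0 < enorm2 v := by
  refine Real.sqrt_pos.2 ((by positivity : 0 ≤ v.1 ^ 2 + v.2 ^ 2).lt_of_ne fun h => hv ?_)
  ext <;> simp <;> nlinarith [sq_nonneg v.1, sq_nonneg v.2]

lemma enorm2_smul {c : ℝ} (hc : 0 ≤ c) (v : ℝ × ℝ) : enorm2 (c • v) = c * enorm2 v := by
  have h : (c • v).1 ^ 2 + (c • v).2 ^ 2 = c ^ 2 * (v.1 ^ 2 + v.2 ^ 2) := by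
    simp only [Prod.smul_fst, Prod.smul_snd, smul_eq_mul]; ring
  rw [enorm2, h, Real.sqrt_mul (sq_nonneg c), Real.sqrt_sq hc, enorm2]

lemma continuous_enorm2 : Continuous enorm2 := by
  unfold enorm2; fun_prop

lemma rotV_injective (θ : ℝ) : Function.Injective (rotV θ) := by
  intro u v h
  simp only [rotV, Prod.mk.injEq] at h
  obtain ⟨h₁, h₂⟩ := h
  have h := Real.sin_sq_add_cos_sq θ
  ext
  · linear_combination cos θ * h₁ + sin θ * h₂ - (u.1 - v.1) * h
  · linear_combination cos θ * h₂ - sin θ * h₁ - (u.2 - v.2) * h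

/-- The power `x ^ r` of the positive part of `x`. -/
def posPow (r x : ℝ) : ℝ := max x 0 ^ r

lemma posPow_nonneg (r x : ℝ) : 0 ≤ posPow r x :=
  Real.rpow_nonneg (le_max_right _ _) _

lemma posPow_of_nonpos {r x : ℝ} (hr : r ≠ 0) (hx : x ≤ 0) : posPow r x = 0 := by
  rw [posPow, max_eq_right hx, Real.zero_rpow hr]

lemma posPow_of_pos {x : ℝ} (r : ℝ) (hx : 0 < x) : posPow r x = x ^ r := by
  rw [posPow, max_eq_left hx.le]

lemma posPow_mul_posPow_neg {r : ℝ} (hr : r ≠ 0) (x : ℝ) : posPow r x * posPow r (-x) = 0 := by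
  rcases le_total x 0 with h | h
  · rw [posPow_of_nonpos hr h, zero_mul]
  · rw [posPow_of_nonpos hr (neg_nonpos.2 h), mul_zero]

lemma continuous_posPow {r : ℝ} (hr : 0 ≤ r) : Continuous (posPow r) :=
  (Real.continuous_rpow_const hr).comp (by fun_prop : Continuous fun x : ℝ => max x 0)

lemma hasDerivAt_posPow {r x : ℝ} (hr : r ≠ 0) (hr' : r - 1 ≠ 0) (hx : x ≠ 0) :
    HasDerivAt (posPow r) (r * posPow (r - 1) x) x := by
  rcases hx.lt_or_gt with h | h
  · rw [posPow_of_nonpos hr' h.le, mul_zero]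
    refine (hasDerivAt_const x (0 : ℝ)).congr_of_eventuallyEq ?_
    filter_upwards [Iio_mem_nhds h] with y hy using posPow_of_nonpos hr (le_of_lt hy)
  · rw [posPow_of_pos _ h]
    refine (Real.hasDerivAt_rpow_const (Or.inl hx)).congr_of_eventuallyEq ?_
    filter_upwards [Ioi_mem_nhds h] with y hy using posPow_of_pos _ hy

lemma intervalIntegrable_posPow {r : ℝ} (hr : -1 < r) (hr' : r ≠ 0) (a b : ℝ) :
    IntervalIntegrable (posPow r) volume a b := by
  have h : posPow r = (Ioi (0 : ℝ)).indicator fun x => x ^ r := by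
    ext x
    by_cases hx : 0 < x
    · rw [posPow_of_pos _ hx, indicator_of_mem (by exact hx)]
    · rw [posPow_of_nonpos hr' (not_lt.1 hx), indicator_of_notMem (by exact hx)]
  have hi := intervalIntegral.intervalIntegrable_rpow' (a := a) (b := b) hr
  rw [h]
  exact ⟨hi.1.indicator measurableSet_Ioi, hi.2.indicator measurableSet_Ioi⟩

lemma integrableOn_posPow_left {r : ℝ} (hr : -1 < r) (hr' : r ≠ 0) :
    IntegrableOn (fun t => posPow r (1 - 2 * t)) (Icc (0 : ℝ) 1) := by
  rw [← intervalIntegrable_iff_integrableOn_Icc_of_le zero_le_one]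
  have h := ((intervalIntegrable_posPow hr hr' 1 (-1)).comp_sub_left 1).comp_mul_left (c := 2)
  norm_num at h
  exact h

lemma integrableOn_posPow_right {r : ℝ} (hr : -1 < r) (hr' : r ≠ 0) :
    IntegrableOn (fun t => posPow r (2 * t - 1)) (Icc (0 : ℝ) 1) := by
  rw [← intervalIntegrable_iff_integrableOn_Icc_of_le zero_le_one]
  have h := ((intervalIntegrable_posPow hr hr' (-1) 1).comp_sub_right 1).comp_mul_left (c := 2)
  norm_num at h
  exact h

/-- The path from `A` to `B` made of two parabolic homothetic motions meeting in a total
collision at time `1 / 2`. -/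
def totalCollisionPath (A B : Fin 4 → ℝ × ℝ) : H1Path4 where
  q t i := posPow (2 / 3) (1 - 2 * t) • A i + posPow (2 / 3) (2 * t - 1) • B i
  v t i := (-(4 / 3) * posPow (-(1 / 3)) (1 - 2 * t)) • A i
    + ((4 / 3) * posPow (-(1 / 3)) (2 * t - 1)) • B i
  hvInt i := by
    have h₁ := integrableOn_posPow_left (r := -(1 / 3)) (by norm_num) (by norm_num)
    have h₂ := integrableOn_posPow_right (r := -(1 / 3)) (by norm_num) (by norm_num)
    exact ((h₁.const_mul _).smul_const _).add ((h₂.const_mul _).smul_const _)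
  hrep i t ht := by
    have h₁ := integrableOn_posPow_left (r := -(1 / 3)) (by norm_num) (by norm_num)
    have h₂ := integrableOn_posPow_right (r := -(1 / 3)) (by norm_num) (by norm_num)
    have hint := ((h₁.const_mul (-(4 / 3))).smul_const (A i)).add
      ((h₂.const_mul (4 / 3)).smul_const (B i))
    rw [MeasureTheory.integral_eq_of_hasDerivAt_off_countable
      (fun s : ℝ => posPow (2 / 3) (1 - 2 * s) • A i + posPow (2 / 3) (2 * s - 1) • B i) _
      (countable_singleton (1 / 2 : ℝ))]
    · abel
    · have hc := continuous_posPow (r := 2 / 3) (by norm_num)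
      exact Continuous.continuousOn (by fun_prop)
    · rintro s ⟨-, hs⟩
      have hs : s ≠ 1 / 2 := hs
      have e₁ : HasDerivAt (fun s : ℝ => 1 - 2 * s) (-2) s := by
        simpa using ((hasDerivAt_id s).const_mul 2).const_sub 1
      have e₂ : HasDerivAt (fun s : ℝ => 2 * s - 1) 2 s := by
        simpa using ((hasDerivAt_id s).const_mul 2).sub_const 1
      have d₁ := (hasDerivAt_posPow (r := 2 / 3) (x := 1 - 2 * s) (by norm_num) (by norm_num)
        (fun h => hs (by linarith))).comp s e₁
      have d₂ := (hasDerivAt_posPow (r := 2 / 3) (x := 2 * s - 1) (by norm_num) (by norm_num)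
        (fun h => hs (by linarith))).comp s e₂
      rw [show (2 / 3 : ℝ) - 1 = -(1 / 3) by norm_num] at d₁ d₂
      refine ((d₁.smul_const (A i)).add (d₂.smul_const (B i))).congr_deriv ?_
      congr 2 <;> ring
    · rw [intervalIntegrable_iff_integrableOn_Icc_of_le ht.1]
      exact IntegrableOn.mono_set hint (Icc_subset_Icc_right ht.2)
  hL2 i := by
    have h₁ := integrableOn_posPow_left (r := -(2 / 3)) (by norm_num) (by norm_num)
    have h₂ := integrableOn_posPow_right (r := -(2 / 3)) (by norm_num) (by norm_num)
    have hsq : ∀ x, posPow (-(1 / 3)) x ^ 2 = posPow (-(2 / 3)) x := fun x => by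
      rw [posPow, posPow, ← Real.rpow_natCast, ← Real.rpow_mul (le_max_right _ _)]
      norm_num
    refine ((h₁.const_mul (16 / 9 * enorm2 (A i) ^ 2)).add
      (h₂.const_mul (16 / 9 * enorm2 (B i) ^ 2))).congr (ae_of_all _ fun t => ?_)
    have hz := posPow_mul_posPow_neg (r := -(1 / 3)) (by norm_num) (1 - 2 * t)
    rw [neg_sub] at hz
    simp only [Pi.add_apply, enorm2_sq, Prod.fst_add, Prod.snd_add, Prod.smul_fst, Prod.smul_snd,
      smul_eq_mul, ← hsq]
    linear_combination (32 / 9 * ((A i).1 * (B i).1 + (A i).2 * (B i).2)) * hz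

/-- The (real-valued) Newtonian potential of a configuration. -/
def potential (c : Fin 4 → ℝ × ℝ) : ℝ :=
  ∑ i : Fin 4, ∑ j ∈ Finset.univ.filter (fun j => i < j), (enorm2 (c i - c j))⁻¹

lemma potential_nonneg (c : Fin 4 → ℝ × ℝ) : 0 ≤ potential c :=
  Finset.sum_nonneg fun _ _ => Finset.sum_nonneg fun _ _ => inv_nonneg.2 (Real.sqrt_nonneg _)

lemma ofReal_potential {c : Fin 4 → ℝ × ℝ} (hc : Function.Injective c) :
    ∑ i : Fin 4, ∑ j ∈ Finset.univ.filter (fun j => i < j),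
      (ENNReal.ofReal (enorm2 (c i - c j)))⁻¹ = ENNReal.ofReal (potential c) := by
  have h (i j : Fin 4) : 0 ≤ (enorm2 (c i - c j))⁻¹ := inv_nonneg.2 (Real.sqrt_nonneg _)
  rw [potential, ENNReal.ofReal_sum_of_nonneg fun i _ => Finset.sum_nonneg fun j _ => h i j]
  refine Finset.sum_congr rfl fun i _ => ?_
  rw [ENNReal.ofReal_sum_of_nonneg fun j _ => h i j]
  refine Finset.sum_congr rfl fun j hj => ?_
  rw [ENNReal.ofReal_inv_of_pos]
  exact enorm2_pos (sub_ne_zero.2 (hc.ne (Finset.mem_filter.1 hj).2.ne))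

lemma continuousAt_potential {c : Fin 4 → ℝ × ℝ} (hc : Function.Injective c) :
    ContinuousAt potential c := by
  refine tendsto_finsetSum _ fun i _ => tendsto_finsetSum _ fun j hj => ?_
  refine ContinuousAt.inv₀ ?_ (enorm2_pos (sub_ne_zero.2
    (hc.ne (Finset.mem_filter.1 hj).2.ne))).ne'
  exact (continuous_enorm2.comp (by fun_prop :
    Continuous fun c : Fin 4 → ℝ × ℝ => c i - c j)).continuousAt

lemma eventually_injective {c : Fin 4 → ℝ × ℝ} (hc : Function.Injective c) :
    ∀ᶠ c' in nhds c, Function.Injective c' := by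
  have h : ∀ᶠ c' in nhds c, ∀ i j : Fin 4, i ≠ j → c' i ≠ c' j := by
    refine Filter.eventually_all.2 fun i => Filter.eventually_all.2 fun j =>
      Filter.eventually_imp_distrib_left.2 fun hij => ?_
    exact (isOpen_ne_fun (continuous_apply i) (continuous_apply j)).mem_nhds (hc.ne hij)
  filter_upwards [h] with c' h' i j hij
  by_contra hne
  exact h' i j hne hij

lemma potential_smul {k : ℝ} (hk : 0 ≤ k) (c : Fin 4 → ℝ × ℝ) :
    potential (k • c) = k⁻¹ * potential c := by
  simp only [potential, Finset.mul_sum, Pi.smul_apply, ← smul_sub, enorm2_smul hk, mul_inv]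

namespace H1Path4

/-- The kinetic energy. -/
def kinetic (p : H1Path4) (t : ℝ) : ℝ := (1 / 2) * ∑ i, enorm2 (p.v t i) ^ 2

lemma kinetic_nonneg (p : H1Path4) (t : ℝ) : 0 ≤ p.kinetic t := by
  unfold kinetic; positivity

lemma integrableOn_kinetic (p : H1Path4) : IntegrableOn p.kinetic (Icc (0 : ℝ) 1) :=
  (integrable_finsetSum _ fun i _ => p.hL2 i).const_mul _

/-- The integrand of the action functional. -/
def lagrangian (p : H1Path4) (t : ℝ) : ℝ≥0∞ :=
  ENNReal.ofReal (p.kinetic t) + ∑ i : Fin 4, ∑ j ∈ Finset.univ.filter (fun j => i < j),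
    (ENNReal.ofReal (enorm2 (p.q t i - p.q t j)))⁻¹

lemma action_eq (p : H1Path4) : action p = ∫⁻ t in Icc (0 : ℝ) 1, p.lagrangian t := rfl

lemma lagrangian_eq (p : H1Path4) {t : ℝ} (ht : Function.Injective (p.q t)) :
    p.lagrangian t = ENNReal.ofReal (p.kinetic t + potential (p.q t)) := by
  rw [lagrangian, ofReal_potential ht,
    ENNReal.ofReal_add (p.kinetic_nonneg t) (potential_nonneg _)]

end H1Path4

lemma action_totalCollisionPath_lt_top {A B : Fin 4 → ℝ × ℝ} (hA : Function.Injective A)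
    (hB : Function.Injective B) : action (totalCollisionPath A B) < ⊤ := by
  have h₁ := integrableOn_posPow_left (r := -(2 / 3)) (by norm_num) (by norm_num)
  have h₂ := integrableOn_posPow_right (r := -(2 / 3)) (by norm_num) (by norm_num)
  have hG := (totalCollisionPath A B).integrableOn_kinetic.add
    ((h₁.mul_const (potential A)).add (h₂.mul_const (potential B)))
  rw [H1Path4.action_eq]
  refine lt_of_le_of_lt (lintegral_mono_ae ?_) (Integrable.lintegral_lt_top hG)
  have hne : ∀ᵐ t : ℝ, t ≠ 1 / 2 := by simp [ae_iff]
  refine ae_restrict_of_ae (hne.mono fun t ht => le_of_eq ?_)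
  have key {k : ℝ} {C : Fin 4 → ℝ × ℝ} (hk : 0 < k) (hC : Function.Injective C)
      (hq : (totalCollisionPath A B).q t = k • C) :
      (totalCollisionPath A B).lagrangian t
        = ENNReal.ofReal ((totalCollisionPath A B).kinetic t + k⁻¹ * potential C) := by
    rw [H1Path4.lagrangian_eq, hq, potential_smul hk.le]
    rw [hq]
    exact (smul_right_injective (ℝ × ℝ) hk.ne').comp hC
  rcases ht.lt_or_gt with h | h
  · have hp : 0 < 1 - 2 * t := by linarith
    have hn : 2 * t - 1 ≤ 0 := by linarith
    rw [key (Real.rpow_pos_of_pos hp (2 / 3)) hA]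
    · simp only [Pi.add_apply]
      rw [posPow_of_pos _ hp, posPow_of_nonpos (by norm_num) hn, Real.rpow_neg hp.le, zero_mul,
        add_zero]
    · ext1 i
      simp only [totalCollisionPath, Pi.smul_apply]
      rw [posPow_of_pos _ hp, posPow_of_nonpos (by norm_num) hn, zero_smul, add_zero]
  · have hp : 0 < 2 * t - 1 := by linarith
    have hn : 1 - 2 * t ≤ 0 := by linarith
    rw [key (Real.rpow_pos_of_pos hp (2 / 3)) hB]
    · simp only [Pi.add_apply]
      rw [posPow_of_pos _ hp, posPow_of_nonpos (by norm_num) hn, Real.rpow_neg hp.le, zero_mul,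
        zero_add]
    · ext1 i
      simp only [totalCollisionPath, Pi.smul_apply]
      rw [posPow_of_pos _ hp, posPow_of_nonpos (by norm_num) hn, zero_smul, zero_add]

lemma exists_inAdm_action_lt_top {θ : ℝ} {E : Set (Fin 4 → ℝ × ℝ)}
    (hE : E = QE1set θ ∨ E = QE2set θ) : ∃ p : H1Path4, inAdm E p ∧ action p < ⊤ := by
  let A : Fin 4 → ℝ × ℝ := ![(-2, 0), (-1, 0), (3 / 2, 1), (3 / 2, -1)]
  let S : Fin 4 → ℝ × ℝ := ![(-1, -1), (-1, 1), (1, 1), (1, -1)]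
  have hA : Function.Injective A := by
    intro i j h
    fin_cases i <;> fin_cases j <;> first | rfl | norm_num [A] at h
  have hS : Function.Injective S := by
    intro i j h
    fin_cases i <;> fin_cases j <;> first | rfl | norm_num [S] at h
  refine ⟨totalCollisionPath A fun i => rotV θ (S i), ⟨fun t _ => ?_, ?_, ?_⟩,
    action_totalCollisionPath_lt_top hA ((rotV_injective θ).comp hS)⟩
  · simp only [totalCollisionPath, Finset.sum_add_distrib, ← Finset.smul_sum]
    have hA₀ : ∑ i, A i = 0 := by
      ext <;> simp only [Fin.sum_univ_four, A] <;> (simp; try norm_num)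
    have hS₀ : ∑ i, rotV θ (S i) = 0 := by
      ext <;> simp only [Fin.sum_univ_four, S, rotV] <;> simp <;> ring
    rw [hA₀, hS₀, smul_zero, smul_zero, add_zero]
  · refine ⟨1, 1, 1, zero_le_one, zero_le_one, ?_⟩
    ext i <;> fin_cases i <;> norm_num [totalCollisionPath, posPow, A]
  · rcases hE with rfl | rfl <;> refine ⟨1, 1, 1, zero_le_one, zero_le_one, ?_⟩ <;>
    · ext i <;> norm_num [totalCollisionPath, posPow, S]

/-- The Euclidean inner product on the configuration space. -/
def configInner (u v : Fin 4 → ℝ × ℝ) : ℝ :=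
  ∑ i, ((u i).1 * (v i).1 + (u i).2 * (v i).2)

namespace H1Path4

/-- The perturbation of a path by the displacement `(δ - t) • η` up to time `δ`. -/
def kick (p : H1Path4) {δ : ℝ} (hδ : δ ∈ Icc (0 : ℝ) 1) (η : Fin 4 → ℝ × ℝ) : H1Path4 where
  q t i := p.q t i + (δ - min t δ) • η i
  v t i := p.v t i - {s | s ≤ δ}.indicator (fun _ => η i) t
  hvInt i := (p.hvInt i).sub ((integrable_const (η i)).indicator measurableSet_Iic)
  hrep i t ht := by
    have h (a : ℝ × ℝ) : ∫ s in (0 : ℝ)..t, {s | s ≤ δ}.indicator (fun _ => a) s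
        = min t δ • a := by
      rcases le_total t δ with htδ | htδ
      · rw [min_eq_left htδ, intervalIntegral.integral_congr (g := fun _ => a)]
        · simp
        · intro s hs
          rw [uIcc_of_le ht.1] at hs
          exact indicator_of_mem (s := {s | s ≤ δ}) (hs.2.trans htδ) fun _ => a
      · rw [intervalIntegral.integral_indicator ⟨hδ.1, htδ⟩]
        simp [htδ]
    rw [intervalIntegral.integral_sub, h, p.hrep i t ht, min_eq_left hδ.1, sub_zero, sub_smul]
    · abel
    · rw [intervalIntegrable_iff_integrableOn_Icc_of_le ht.1]
      exact (p.hvInt i).mono_set (Icc_subset_Icc_right ht.2)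
    · rw [intervalIntegrable_iff_integrableOn_Icc_of_le ht.1]
      exact (integrable_const (η i)).indicator measurableSet_Iic
  hL2 i := by
    have h₁ := (((p.hvInt i).fst.mul_const (η i).1).add
      ((p.hvInt i).snd.mul_const (η i).2)).const_mul (-2)
    have h₂ := (h₁.add (integrable_const (enorm2 (η i) ^ 2))).indicator
      (measurableSet_Iic (a := δ))
    refine ((p.hL2 i).add h₂).congr (ae_of_all _ fun t => ?_)
    by_cases ht : t ≤ δ
    · simp only [Pi.add_apply, indicator_of_mem (show t ∈ Iic δ from ht),
        indicator_of_mem (show t ∈ {s | s ≤ δ} from ht), enorm2_sq, Prod.fst_sub, Prod.snd_sub]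
      ring
    · simp only [Pi.add_apply, indicator_of_notMem (show t ∉ Iic δ from ht),
        indicator_of_notMem (show t ∉ {s | s ≤ δ} from ht), add_zero, sub_zero]

variable {p : H1Path4} {δ : ℝ} {hδ : δ ∈ Icc (0 : ℝ) 1} {η : Fin 4 → ℝ × ℝ}

lemma kick_q_of_le {t : ℝ} (ht : t ≤ δ) : (p.kick hδ η).q t = p.q t + (δ - t) • η := by
  ext1 i
  simp only [kick, min_eq_left ht, Pi.add_apply, Pi.smul_apply]

lemma kick_q_of_ge {t : ℝ} (ht : δ ≤ t) : (p.kick hδ η).q t = p.q t := by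
  ext1 i
  simp only [kick, min_eq_right ht, sub_self, zero_smul, add_zero]

lemma kinetic_kick_of_le {t : ℝ} (ht : t ≤ δ) :
    (p.kick hδ η).kinetic t
      = p.kinetic t - configInner (p.v t) η + 1 / 2 * configInner η η := by
  simp only [kinetic, kick, configInner, indicator_of_mem (show t ∈ {s | s ≤ δ} from ht),
    enorm2_sq, Prod.fst_sub, Prod.snd_sub, Finset.mul_sum, ← Finset.sum_sub_distrib,
    ← Finset.sum_add_distrib]
  exact Finset.sum_congr rfl fun i _ => by ring

lemma lagrangian_kick_of_gt {t : ℝ} (ht : δ < t) :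
    (p.kick hδ η).lagrangian t = p.lagrangian t := by
  have h : (p.kick hδ η).v t = p.v t := by
    ext1 i
    simp only [kick, indicator_of_notMem (show t ∉ {s | s ≤ δ} from ht.not_ge), sub_zero]
  simp only [lagrangian, kinetic, h, kick_q_of_ge ht.le]

lemma integrableOn_configInner_v (p : H1Path4) (η : Fin 4 → ℝ × ℝ) :
    IntegrableOn (fun t => configInner (p.v t) η) (Icc (0 : ℝ) 1) :=
  integrable_finsetSum _ fun i _ =>
    ((p.hvInt i).fst.mul_const _).add ((p.hvInt i).snd.mul_const _)

lemma setIntegral_configInner_v (p : H1Path4) (hδ : δ ∈ Icc (0 : ℝ) 1) (η : Fin 4 → ℝ × ℝ) :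
    ∫ t in Icc 0 δ, configInner (p.v t) η = configInner (p.q δ - p.q 0) η := by
  have hv (i : Fin 4) : IntegrableOn (fun t => p.v t i) (Icc 0 δ) :=
    (p.hvInt i).mono_set (Icc_subset_Icc_right hδ.2)
  have hq (i : Fin 4) : ∫ t in Icc 0 δ, p.v t i = p.q δ i - p.q 0 i := by
    rw [p.hrep i δ hδ, intervalIntegral.integral_of_le hδ.1, integral_Icc_eq_integral_Ioc]
    abel
  have hi (i : Fin 4) : IntegrableOn
      (fun t => (p.v t i).1 * (η i).1 + (p.v t i).2 * (η i).2) (Icc 0 δ) :=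
    ((hv i).fst.mul_const _).add ((hv i).snd.mul_const _)
  unfold configInner
  rw [integral_finsetSum _ fun i _ => hi i]
  refine Finset.sum_congr rfl fun i _ => ?_
  rw [integral_add ((hv i).fst.mul_const _) ((hv i).snd.mul_const _), integral_mul_const,
    integral_mul_const, ← fst_integral (hv i), ← snd_integral (hv i), hq, Pi.sub_apply]

/-- If replacing `p` by its perturbation does not decrease the action, then the same holds for the
actions on the interval `[0, δ]` where the two paths differ. -/
lemma setLIntegral_lagrangian_le (hfin : action p < ⊤) (hle : action p ≤ action (p.kick hδ η)) :
    ∫⁻ t in Icc 0 δ, p.lagrangian t ≤ ∫⁻ t in Icc 0 δ, (p.kick hδ η).lagrangian t := by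
  have hdisj : Disjoint (Icc 0 δ) (Ioc δ 1) :=
    disjoint_left.2 fun t h h' => h'.1.not_ge h.2
  have hsplit (r : H1Path4) : action r
      = (∫⁻ t in Icc 0 δ, r.lagrangian t) + ∫⁻ t in Ioc δ 1, r.lagrangian t := by
    rw [← lintegral_union measurableSet_Ioc hdisj, Icc_union_Ioc_eq_Icc hδ.1 hδ.2, action_eq]
  rw [hsplit p] at hfin
  rw [hsplit p, hsplit, setLIntegral_congr_fun measurableSet_Ioc
    (fun t ht => lagrangian_kick_of_gt (p := p) (hδ := hδ) (η := η) ht.1)] at hle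
  exact (ENNReal.add_le_add_iff_right (ENNReal.add_lt_top.1 hfin).2.ne).1 hle

lemma configInner_sub_le (hfin : action p < ⊤) (hle : action p ≤ action (p.kick hδ η))
    {m M : ℝ} (hm : 0 ≤ m) (hinj : ∀ t ∈ Icc 0 δ, Function.Injective (p.q t))
    (hinj' : ∀ t ∈ Icc 0 δ, Function.Injective ((p.kick hδ η).q t))
    (hpm : ∀ t ∈ Icc 0 δ, m ≤ potential (p.q t))
    (hpM : ∀ t ∈ Icc 0 δ, potential ((p.kick hδ η).q t) ≤ M) :
    configInner (p.q δ - p.q 0) η ≤ δ * (1 / 2 * configInner η η + (M - m)) := by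
  have hM : 0 ≤ M := (potential_nonneg _).trans (hpM 0 ⟨le_rfl, hδ.1⟩)
  have hsub : Icc 0 δ ⊆ Icc (0 : ℝ) 1 := Icc_subset_Icc_right hδ.2
  have hK : IntegrableOn p.kinetic (Icc 0 δ) := p.integrableOn_kinetic.mono_set hsub
  have hK' : IntegrableOn (p.kick hδ η).kinetic (Icc 0 δ) :=
    (p.kick hδ η).integrableOn_kinetic.mono_set hsub
  have hv := (p.integrableOn_configInner_v η).mono_set hsub
  have hc (x : ℝ) : IntegrableOn (fun _ => x) (Icc 0 δ) := integrable_const x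
  have hKm : IntegrableOn (fun t => p.kinetic t + m) (Icc 0 δ) := hK.add (hc m)
  have hKM : IntegrableOn (fun t => (p.kick hδ η).kinetic t + M) (Icc 0 δ) := hK'.add (hc M)
  have hlow : ENNReal.ofReal (∫ t in Icc 0 δ, (p.kinetic t + m))
      ≤ ∫⁻ t in Icc 0 δ, p.lagrangian t := by
    rw [ofReal_integral_eq_lintegral_ofReal hKm
      (ae_of_all _ fun t => add_nonneg (p.kinetic_nonneg t) hm)]
    refine setLIntegral_mono_ae' measurableSet_Icc (ae_of_all _ fun t ht => ?_)
    rw [p.lagrangian_eq (hinj t ht)]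
    exact ENNReal.ofReal_le_ofReal (by linarith [hpm t ht])
  have hupp : ∫⁻ t in Icc 0 δ, (p.kick hδ η).lagrangian t
      ≤ ENNReal.ofReal (∫ t in Icc 0 δ, ((p.kick hδ η).kinetic t + M)) := by
    rw [ofReal_integral_eq_lintegral_ofReal hKM
      (ae_of_all _ fun t => add_nonneg (kinetic_nonneg _ t) hM)]
    refine setLIntegral_mono_ae' measurableSet_Icc (ae_of_all _ fun t ht => ?_)
    rw [lagrangian_eq _ (hinj' t ht)]
    exact ENNReal.ofReal_le_ofReal (by linarith [hpM t ht])
  have h := (ENNReal.ofReal_le_ofReal_iff (integral_nonneg fun t =>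
    add_nonneg (kinetic_nonneg _ t) hM)).1
    ((hlow.trans (setLIntegral_lagrangian_le hfin hle)).trans hupp)
  have hKv : IntegrableOn (fun t => p.kinetic t - configInner (p.v t) η) (Icc 0 δ) := hK.sub hv
  have hkin : ∫ t in Icc 0 δ, (p.kick hδ η).kinetic t
      = ∫ t in Icc 0 δ, (p.kinetic t - configInner (p.v t) η + 1 / 2 * configInner η η) :=
    setIntegral_congr_fun measurableSet_Icc fun t ht => kinetic_kick_of_le ht.2
  rw [integral_add hK' (hc M), hkin, integral_add hKv (hc _), integral_sub hK hv,
    integral_add hK (hc m), setIntegral_configInner_v p hδ] at h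
  simp only [setIntegral_const, Real.volume_real_Icc, smul_eq_mul, sub_zero,
    max_eq_left hδ.1] at h
  linarith

end H1Path4

lemma configInner_smul_left (k : ℝ) (u v : Fin 4 → ℝ × ℝ) :
    configInner (k • u) v = k * configInner u v := by
  simp only [configInner, Pi.smul_apply, Prod.smul_fst, Prod.smul_snd, smul_eq_mul,
    Finset.mul_sum]
  exact Finset.sum_congr rfl fun i _ => by ring

lemma configInner_smul_right (k : ℝ) (u v : Fin 4 → ℝ × ℝ) :
    configInner u (k • v) = k * configInner u v := by
  simp only [configInner, Pi.smul_apply, Prod.smul_fst, Prod.smul_snd, smul_eq_mul,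
    Finset.mul_sum]
  exact Finset.sum_congr rfl fun i _ => by ring

/-- One-sided first variation at the initial time: if the small perturbations of `p` in the
direction `η` do not decrease the action, then `η` satisfies a quadratic inequality against the
initial velocity. -/
lemma H1Path4.configInner_velocity_le {p : H1Path4} {w : Fin 4 → ℝ × ℝ}
    (hw : ∀ i : Fin 4, HasDerivWithinAt (fun t => p.q t i) (w i) (Ici (0:ℝ)) 0)
    (hfin : action p < ⊤) (hinj : Function.Injective (p.q 0)) (η : Fin 4 → ℝ × ℝ)
    (hmin : ∀ᶠ δ in nhdsWithin (0 : ℝ) (Ioi 0), ∀ hδ : δ ∈ Icc (0 : ℝ) 1,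
      action p ≤ action (p.kick hδ η)) :
    configInner w η ≤ 1 / 2 * configInner η η := by
  refine le_of_forall_pos_le_add fun ε hε => ?_
  have hU : ∀ᶠ c in nhds (p.q 0),
      Function.Injective c ∧ |potential c - potential (p.q 0)| < ε / 2 :=
    (eventually_injective hinj).and
      (Metric.continuousAt_iff'.1 (continuousAt_potential hinj) (ε / 2) (half_pos hε))
  have hq : Filter.Tendsto p.q (nhdsWithin 0 (Ici 0)) (nhds (p.q 0)) :=
    tendsto_pi_nhds.2 fun i => (hw i).continuousWithinAt
  have hs : Filter.Tendsto (fun s : ℝ => s • η) (nhdsWithin 0 (Ici 0)) (nhds 0) := by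
    have h : Continuous fun s : ℝ => s • η := by fun_prop
    simpa using (h.tendsto 0).mono_left nhdsWithin_le_nhds
  have htend := (hq.comp Filter.tendsto_fst).add (hs.comp Filter.tendsto_snd)
  rw [add_zero] at htend
  obtain ⟨P, hP, P', hP', hPP'⟩ := Filter.eventually_prod_iff.1 (htend.eventually hU)
  obtain ⟨r, hr, hrP⟩ := mem_nhdsGE_iff_exists_Ico_subset.1 hP
  obtain ⟨r', hr', hrP'⟩ := mem_nhdsGE_iff_exists_Ico_subset.1 hP'
  have hslope : Filter.Tendsto (fun δ : ℝ => δ⁻¹ • (p.q δ - p.q 0)) (nhdsWithin 0 (Ioi 0))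
      (nhds w) := by
    refine tendsto_pi_nhds.2 fun i => ?_
    have h := (hasDerivWithinAt_iff_tendsto_slope' (lt_irrefl (0 : ℝ))).1
      ((hw i).mono Ioi_subset_Ici_self)
    exact h.congr fun δ => by simp [slope_def_module]
  have hcont : Continuous fun u : Fin 4 → ℝ × ℝ => configInner u η := by
    unfold configInner; fun_prop
  refine le_of_tendsto ((hcont.tendsto w).comp hslope) ?_
  filter_upwards [hmin, self_mem_nhdsWithin, mem_nhdsWithin_of_mem_nhds (Iio_mem_nhds hr),
    mem_nhdsWithin_of_mem_nhds (Iio_mem_nhds hr'),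
    mem_nhdsWithin_of_mem_nhds (Iio_mem_nhds (zero_lt_one' ℝ))] with δ hδmin hδ₀ hδr hδr' hδ₁
  have hδ₀ : 0 < δ := hδ₀
  have hδ₁ : δ < 1 := hδ₁
  have hδ : δ ∈ Icc (0 : ℝ) 1 := ⟨hδ₀.le, hδ₁.le⟩
  have hgood {t s : ℝ} (ht : t ∈ Icc 0 δ) (hs : s ∈ Icc 0 δ) :
      Function.Injective (p.q t + s • η) ∧
        |potential (p.q t + s • η) - potential (p.q 0)| < ε / 2 :=
    hPP' (hrP ⟨ht.1, ht.2.trans_lt hδr⟩) (hrP' ⟨hs.1, hs.2.trans_lt hδr'⟩)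
  have hgood₀ {t : ℝ} (ht : t ∈ Icc 0 δ) :
      Function.Injective (p.q t) ∧ |potential (p.q t) - potential (p.q 0)| < ε / 2 := by
    simpa using hgood ht ⟨le_refl (0 : ℝ), hδ₀.le⟩
  have hgood' {t : ℝ} (ht : t ∈ Icc 0 δ) := by
    have h := hgood ht (s := δ - t) ⟨by linarith [ht.2], by linarith [ht.1]⟩
    rwa [← H1Path4.kick_q_of_le (hδ := hδ) ht.2] at h
  have h := H1Path4.configInner_sub_le hfin (hδmin hδ)
    (m := max (potential (p.q 0) - ε / 2) 0) (M := potential (p.q 0) + ε / 2) (le_max_right _ _)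
    (fun t ht => (hgood₀ ht).1) (fun t ht => (hgood' ht).1)
    (fun t ht => max_le (by linarith [(abs_lt.1 (hgood₀ ht).2).1]) (potential_nonneg _))
    (fun t ht => by linarith [(abs_lt.1 (hgood' ht).2).2])
  rw [Function.comp_apply, configInner_smul_left, inv_mul_le_iff₀ hδ₀]
  refine h.trans (mul_le_mul_of_nonneg_left ?_ hδ₀.le)
  linarith [le_max_left (potential (p.q 0) - ε / 2) 0]

lemma eq_zero_of_forall_mul_le_sq_mul {x y : ℝ} (h : ∀ k : ℝ, k * x ≤ k ^ 2 * y) : x = 0 := by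
  have hy : 0 ≤ y := by linarith [h 1, h (-1)]
  have hk := h (x / (2 * y + 1))
  rw [div_pow, div_mul_eq_mul_div, div_mul_eq_mul_div,
    div_le_div_iff₀ (by positivity) (by positivity)] at hk
  have hk' : x * x * (2 * y + 1) ≤ x ^ 2 * y :=
    le_of_mul_le_mul_right (by linarith) (by positivity : 0 < 2 * y + 1)
  nlinarith [mul_nonneg (sq_nonneg x) hy, sq_nonneg x]

/-- The configurations satisfying the linear relations which define `QSset`. -/
def isoscelesConfig (a b c : ℝ) : Fin 4 → ℝ × ℝ :=
  ![(-a - c, 0), (-a, 0), ((2 * a + c) / 2, b), ((2 * a + c) / 2, -b)]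

lemma isoscelesConfig_add_smul (a b c a' b' c' k : ℝ) :
    isoscelesConfig a b c + k • isoscelesConfig a' b' c'
      = isoscelesConfig (a + k * a') (b + k * b') (c + k * c') := by
  ext i <;> fin_cases i <;> simp [isoscelesConfig] <;> ring

lemma sum_isoscelesConfig (a b c : ℝ) : ∑ i, isoscelesConfig a b c i = 0 := by
  ext <;> simp only [Fin.sum_univ_four, isoscelesConfig] <;> simp
  ring

lemma inAdm.kick {E : Set (Fin 4 → ℝ × ℝ)} {p : H1Path4} (hp : inAdm E p) {δ : ℝ}
    (hδ : δ ∈ Icc (0 : ℝ) 1) {η : Fin 4 → ℝ × ℝ} (hη : ∑ i, η i = 0)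
    (hS : p.q 0 + δ • η ∈ QSset) : inAdm E (p.kick hδ η) := by
  refine ⟨fun t ht => ?_, ?_, ?_⟩
  · simp only [H1Path4.kick, Finset.sum_add_distrib, ← Finset.smul_sum, hη, smul_zero, add_zero]
    exact hp.1 t ht
  · rwa [H1Path4.kick_q_of_le hδ.1, sub_zero]
  · rw [H1Path4.kick_q_of_ge hδ.2]
    exact hp.2.2

/-- The initial velocity of a minimizer without collision at the initial time is orthogonal to the
tangent space of `QSset`. -/
lemma configInner_isoscelesConfig_eq_zero {E : Set (Fin 4 → ℝ × ℝ)} {p : H1Path4}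
    (hp : isMin E p) (hfin : action p < ⊤) {w : Fin 4 → ℝ × ℝ}
    (hw : ∀ i : Fin 4, HasDerivWithinAt (fun t => p.q t i) (w i) (Ici (0:ℝ)) 0)
    (hinj : Function.Injective (p.q 0)) (a b c : ℝ) :
    configInner w (isoscelesConfig a b c) = 0 := by
  obtain ⟨a₁, b₁, c₁, hb, hc, hq⟩ := hp.1.2.1
  have hb : 0 < b₁ := hb.lt_of_ne' fun h => by
    have := hinj.ne (by decide : (2 : Fin 4) ≠ 3)
    simp [hq, h] at this
  have hc : 0 < c₁ := hc.lt_of_ne' fun h => by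
    have := hinj.ne (by decide : (0 : Fin 4) ≠ 1)
    simp [hq, h] at this
  refine eq_zero_of_forall_mul_le_sq_mul
    (y := 1 / 2 * configInner (isoscelesConfig a b c) (isoscelesConfig a b c)) fun k => ?_
  have hmin : ∀ᶠ δ in nhdsWithin (0 : ℝ) (Ioi 0), ∀ hδ : δ ∈ Icc (0 : ℝ) 1,
      action p ≤ action (p.kick hδ (k • isoscelesConfig a b c)) := by
    have hpos {x : ℝ} (hx : 0 < x) (y : ℝ) :
        ∀ᶠ δ in nhdsWithin (0 : ℝ) (Ioi 0), 0 < x + δ * k * y := by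
      have h : ContinuousAt (fun δ : ℝ => x + δ * k * y) 0 := by fun_prop
      exact (h.eventually_const_lt (by simpa using hx)).filter_mono nhdsWithin_le_nhds
    filter_upwards [hpos hb b, hpos hc c] with δ hδb hδc hδ
    refine hp.2 _ (hp.1.kick hδ ?_ ⟨a₁ + δ * k * a, b₁ + δ * k * b,
      c₁ + δ * k * c, hδb.le, hδc.le, ?_⟩)
    · simp only [Pi.smul_apply, ← Finset.smul_sum, sum_isoscelesConfig, smul_zero]
    · rw [smul_smul, hq]
      exact isoscelesConfig_add_smul a₁ b₁ c₁ a b c (δ * k)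
  have h := H1Path4.configInner_velocity_le hw hfin hinj _ hmin
  rw [configInner_smul_left, configInner_smul_right, configInner_smul_right] at h
  linarith

lemma sum_velocity_eq_zero {p : H1Path4} (hp : p.inChi) {w : Fin 4 → ℝ × ℝ}
    (hw : ∀ i : Fin 4, HasDerivWithinAt (fun t => p.q t i) (w i) (Ici (0:ℝ)) 0) :
    ∑ i, w i = 0 := by
  have h := (HasDerivWithinAt.fun_sum fun i (_ : i ∈ Finset.univ) => hw i).mono
    (Icc_subset_Ici_self : Icc (0 : ℝ) 1 ⊆ Ici 0)
  have h₀ := (hasDerivWithinAt_const (0 : ℝ) (Icc (0 : ℝ) 1) (0 : ℝ × ℝ)).congr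
    (fun t ht => hp t ht) (hp 0 ⟨le_rfl, zero_le_one⟩)
  exact (uniqueDiffOn_Icc_zero_one 0 ⟨le_rfl, zero_le_one⟩).eq_deriv _ h h₀

/-- the first-variation conditions at `t = 0` for a minimizer without
collision at `t = 0` force `q̇₁ₓ(0) = q̇₂ₓ(0) = 0`, `q̇₃ₓ(0) = −q̇₄ₓ(0)` and
`q̇₃ᵧ(0) = q̇₄ᵧ(0)`. -/
theorem statement7 (θ : ℝ) (E : Set (Fin 4 → ℝ × ℝ))
    (hE : E = QE1set θ ∨ E = QE2set θ)
    (p : H1Path4) (hp : isMin E p)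
    (w : Fin 4 → ℝ × ℝ)
    (hw : ∀ i : Fin 4, HasDerivWithinAt (fun t => p.q t i) (w i) (Ici (0:ℝ)) 0)
    (hnc : ∀ i j : Fin 4, i ≠ j → p.q 0 i ≠ p.q 0 j) :
    (w 0).1 = 0 ∧ (w 1).1 = 0 ∧ (w 2).1 = -(w 3).1 ∧ (w 2).2 = (w 3).2 := by
  have hinj : Function.Injective (p.q 0) := fun i j h => by_contra fun hij => hnc i j hij h
  obtain ⟨p₀, hp₀, hfin⟩ := exists_inAdm_action_lt_top hE
  have horth := configInner_isoscelesConfig_eq_zero hp ((hp.2 p₀ hp₀).trans_lt hfin) hw hinj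
  have hsum := congrArg Prod.fst (sum_velocity_eq_zero hp.1.1 hw)
  have ha := horth 1 0 0
  have hb := horth 0 1 0
  have hc := horth 0 0 1
  simp [configInner, isoscelesConfig, Fin.sum_univ_four] at ha hb hc hsum
  refine ⟨?_, ?_, ?_, ?_⟩ <;> linarith

end
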